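/- For n > 4, applying the mincut graph operator twice to the wheel W_n yields X(X(W_n)) ≅ L(K_{n−1}), the line graph of K_{n−1}, and any further application of X leaves the isomorphism type unchanged: X(L(K_{n−1})) ≅ L(K_{n−1}). -/

import Mathlib

open SimpleGraph

variable {V : Type*}

/-- `X` is an edge-cut of `G`: a set of edges of `G` whose deletion disconnects `G`. -/
def IsEdgeCut (G : SimpleGraph V) (X : Set (Sym2 V)) : Prop :=
  X ⊆ G.edgeSet ∧ ¬ (G.deleteEdges X).Connected

/-- `X` is a minimum edge-cut (mincut) of `G`. -/
def IsMinCut (G : SimpleGraph V) (X : Set (Sym2 V)) : Prop :=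
  IsEdgeCut G X ∧ ∀ Y : Set (Sym2 V), IsEdgeCut G Y → X.ncard ≤ Y.ncard

/-- The edge connectivity of `G`: minimum cardinality of an edge-cut. -/
noncomputable def edgeConn (G : SimpleGraph V) : ℕ :=
  sInf {n | ∃ X : Set (Sym2 V), IsEdgeCut G X ∧ X.ncard = n}

/-- The mincut graph `X(G)`: intersection graph of the minimum edge-cuts of `G`. -/
def mincutGraph (G : SimpleGraph V) : SimpleGraph {X : Set (Sym2 V) // IsMinCut G X} :=
  SimpleGraph.fromRel (fun A B => (A.1 ∩ B.1).Nonempty)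

/-- The wheel graph with `k` rim vertices and a hub (`none`). -/
def wheelGraph (k : Nat) : SimpleGraph (Option (Fin k)) :=
  SimpleGraph.fromRel (fun a b =>
    (a = none ∧ b ≠ none) ∨
      ∃ i j : Fin k, a = some i ∧ b = some j ∧ (SimpleGraph.cycleGraph k).Adj i j)

/-- The edge boundary of a vertex set. -/
def bdry {V : Type*} (G : SimpleGraph V) (S : Set V) : Set (Sym2 V) :=
  {e | ∃ u v, u ∈ S ∧ v ∉ S ∧ G.Adj u v ∧ e = s(u, v)}

lemma bdry_compl {V : Type*} (G : SimpleGraph V) (S : Set V) : bdry G Sᶜ = bdry G S := by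
  ext e
  constructor
  · rintro ⟨u, v, hu, hv, h, rfl⟩
    exact ⟨v, u, by simpa using hv, hu, h.symm, Sym2.eq_swap⟩
  · rintro ⟨u, v, hu, hv, h, rfl⟩
    exact ⟨v, u, hv, by simpa using hu, h.symm, Sym2.eq_swap⟩

lemma mem_bdry {V : Type*} (G : SimpleGraph V) (S : Set V) (u v : V) :
    s(u, v) ∈ bdry G S ↔ G.Adj u v ∧ ((u ∈ S ∧ v ∉ S) ∨ (v ∈ S ∧ u ∉ S)) := by
  constructor
  · rintro ⟨a, b, ha, hb, h, he⟩
    rw [Sym2.eq_iff] at he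
    rcases he with ⟨rfl, rfl⟩ | ⟨rfl, rfl⟩
    · exact ⟨h, Or.inl ⟨ha, hb⟩⟩
    · exact ⟨h.symm, Or.inr ⟨ha, hb⟩⟩
  · rintro ⟨h, ⟨ha, hb⟩ | ⟨ha, hb⟩⟩
    · exact ⟨u, v, ha, hb, h, rfl⟩
    · exact ⟨v, u, ha, hb, h.symm, Sym2.eq_swap⟩

lemma bdry_singleton {V : Type*} (G : SimpleGraph V) (w : V) :
    bdry G {w} = G.incidenceSet w := by
  ext e
  induction e with | _ a b =>
  rw [mem_bdry, SimpleGraph.mk'_mem_incidenceSet_iff]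
  constructor
  · rintro ⟨h, ⟨ha, hb⟩ | ⟨ha, hb⟩⟩
    · exact ⟨h, Or.inl ha.symm⟩
    · exact ⟨h, Or.inr ha.symm⟩
  · rintro ⟨h, rfl | rfl⟩
    · exact ⟨h, Or.inl ⟨rfl, fun h' => h.ne h'.symm⟩⟩
    · exact ⟨h, Or.inr ⟨rfl, fun h' => h.ne h'⟩⟩

lemma bdry_isEdgeCut {V : Type*} (G : SimpleGraph V) (S : Set V) (h1 : S.Nonempty)
    (h2 : Sᶜ.Nonempty) : IsEdgeCut G (bdry G S) := by
  constructor
  · rintro e ⟨u, v, hu, hv, h, rfl⟩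
    exact h
  · intro hc
    obtain ⟨a, ha⟩ := h1
    obtain ⟨b, hb⟩ := h2
    obtain ⟨p⟩ := hc.preconnected a b
    obtain ⟨d, hd, h3, h4⟩ := p.exists_boundary_dart S ha hb
    have := d.adj
    rw [SimpleGraph.deleteEdges_adj] at this
    exact this.2 ⟨_, _, h3, h4, this.1, rfl⟩

lemma edgeCut_exists {V : Type*} [Nonempty V] (G : SimpleGraph V) (X : Set (Sym2 V))
    (h : IsEdgeCut G X) : ∃ S : Set V, S.Nonempty ∧ Sᶜ.Nonempty ∧ bdry G S ⊆ X := by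
  have h2 : ¬ (G.deleteEdges X).Preconnected := fun h3 => h.2 ⟨h3⟩
  unfold SimpleGraph.Preconnected at h2
  push Not at h2
  obtain ⟨a, b, hab⟩ := h2
  refine ⟨{x | (G.deleteEdges X).Reachable a x}, ⟨a, SimpleGraph.Reachable.refl a⟩, ⟨b, hab⟩, ?_⟩
  rintro e ⟨u, v, hu, hv, hadj, rfl⟩
  by_contra hX
  apply hv
  have : (G.deleteEdges X).Adj u v := by
    rw [SimpleGraph.deleteEdges_adj]; exact ⟨hadj, hX⟩
  exact SimpleGraph.Reachable.trans hu this.reachable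

/-- Building an isomorphism onto the mincut graph. -/
lemma iso_of_cuts {U V : Type*} (G : SimpleGraph V) (H : SimpleGraph U) (f : U → Set (Sym2 V))
    (hinj : Function.Injective f) (hr : ∀ X, IsMinCut G X ↔ ∃ u, f u = X)
    (hadj : ∀ u v, u ≠ v → (H.Adj u v ↔ (f u ∩ f v).Nonempty)) :
    Nonempty (mincutGraph G ≃g H) := by
  let F : U → {X : Set (Sym2 V) // IsMinCut G X} := fun u => ⟨f u, (hr _).2 ⟨u, rfl⟩⟩
  have hF : Function.Bijective F := by
    constructor
    · intro a b h
      exact hinj (congrArg Subtype.val h)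
    · rintro ⟨X, hX⟩
      obtain ⟨u, hu⟩ := (hr X).1 hX
      exact ⟨u, Subtype.ext hu⟩
  refine ⟨SimpleGraph.Iso.symm ⟨Equiv.ofBijective F hF, ?_⟩⟩
  intro a b
  simp only [Equiv.ofBijective_apply, mincutGraph, SimpleGraph.fromRel_adj]
  constructor
  · rintro ⟨h1, h2⟩
    have hab : a ≠ b := fun h => h1 (by rw [h])
    rw [hadj a b hab]
    rcases h2 with h2 | h2
    · exact h2
    · rw [Set.inter_comm]; exact h2
  · intro h
    refine ⟨fun h' => h.ne (hF.1 h'), Or.inl ?_⟩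
    exact (hadj a b h.ne).1 h

lemma edgeCut_map {V W : Type*} {G : SimpleGraph V} {H : SimpleGraph W} (e : G ≃g H)
    (X : Set (Sym2 V)) (h : IsEdgeCut G X) : IsEdgeCut H (Sym2.map e '' X) := by
  constructor
  · rintro _ ⟨x, hx, rfl⟩
    have := h.1 hx
    induction x with | _ a b =>
    exact e.map_adj_iff.2 this
  · intro hc
    apply h.2
    have hinj : Function.Injective (Sym2.map e) := Sym2.map.injective e.injective
    let E : G.deleteEdges X ≃g H.deleteEdges (Sym2.map e '' X) := ⟨e.toEquiv, by
      intro a b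
      rw [SimpleGraph.deleteEdges_adj, SimpleGraph.deleteEdges_adj]
      have h1 : s(e a, e b) ∈ Sym2.map e '' X ↔ s(a, b) ∈ X := by
        rw [← Sym2.map_mk, hinj.mem_set_image]
      have h2 : H.Adj (e a) (e b) ↔ G.Adj a b := e.map_adj_iff
      exact and_congr h2 (not_congr h1)⟩
    exact E.connected_iff.2 hc

lemma minCut_map {V W : Type*} {G : SimpleGraph V} {H : SimpleGraph W} (e : G ≃g H)
    (X : Set (Sym2 V)) (h : IsMinCut G X) : IsMinCut H (Sym2.map e '' X) := by
  refine ⟨edgeCut_map e X h.1, fun Y hY => ?_⟩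
  rw [Set.ncard_image_of_injective _ (Sym2.map.injective e.injective)]
  have := h.2 _ (edgeCut_map e.symm Y hY)
  rwa [Set.ncard_image_of_injective _ (Sym2.map.injective e.symm.injective)] at this

lemma mincutGraph_congr {V W : Type*} {G : SimpleGraph V} {H : SimpleGraph W} (e : G ≃g H) :
    Nonempty (mincutGraph H ≃g mincutGraph G) := by
  have hinj : Function.Injective (Sym2.map e) := Sym2.map.injective e.injective
  refine iso_of_cuts H (mincutGraph G) (fun X => Sym2.map e '' X.1) ?_ ?_ ?_
  · intro X Y h
    exact Subtype.ext (hinj.image_injective h)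
  · intro X
    constructor
    · intro hX
      refine ⟨⟨_, minCut_map e.symm X hX⟩, ?_⟩
      simp only [Set.image_image, Sym2.map_map]
      have hid : (e ∘ e.symm : W → W) = id := by
        funext x
        simp
      rw [hid, Sym2.map_id]
      simp
    · rintro ⟨u, rfl⟩
      exact minCut_map e _ u.2
  · intro u v huv
    rw [← Set.image_inter hinj, Set.image_nonempty]
    simp only [mincutGraph, SimpleGraph.fromRel_adj, Set.inter_comm v.1 u.1, or_self]
    exact ⟨fun h => h.2, fun h => ⟨huv, h⟩⟩

/-- If the minimum cuts are exactly the stars at the vertices `g u`. -/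
lemma iso_of_super {U V : Type*} [Finite V] [Nonempty U] (G : SimpleGraph V) (g : U → V)
    (hg : Function.Injective g) (D : ℕ) (hD : 2 ≤ D)
    (hdeg : ∀ u, (bdry G {g u}).ncard = D)
    (h : ∀ S : Set V, S.Nonempty → Sᶜ.Nonempty → (bdry G S).ncard ≤ D →
      ∃ u, S = {g u} ∨ Sᶜ = {g u}) :
    Nonempty (mincutGraph G ≃g G.comap g) := by
  have hV : Nonempty V := ⟨g (Classical.arbitrary U)⟩
  have hcut : ∀ u, IsEdgeCut G (bdry G {g u}) := by
    intro u
    apply bdry_isEdgeCut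
    · simp
    · by_contra hne
      rw [Set.not_nonempty_iff_eq_empty] at hne
      have h0 : bdry G {g u} = ∅ := by
        rw [← bdry_compl, hne]
        ext e
        simp [bdry]
      have := hdeg u
      rw [h0] at this
      simp at this
      omega
  have key : ∀ X, IsEdgeCut G X → X.ncard ≤ D → ∃ u, bdry G {g u} = X := by
    intro X hX hXD
    obtain ⟨S, h1, h2, h3⟩ := edgeCut_exists G X hX
    have hle : (bdry G S).ncard ≤ X.ncard := Set.ncard_le_ncard h3
    obtain ⟨u, hu⟩ := h S h1 h2 (hle.trans hXD)
    have hS : bdry G S = bdry G {g u} := by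
      rcases hu with hu | hu
      · rw [hu]
      · rw [← bdry_compl, hu]
    refine ⟨u, ?_⟩
    rw [hS] at h3
    apply Set.eq_of_subset_of_ncard_le h3
    rw [hdeg]; exact hXD
  refine iso_of_cuts G (G.comap g) (fun u => bdry G {g u}) ?_ ?_ ?_
  · intro a b hab
    by_contra hne
    have hne' : g a ≠ g b := fun h => hne (hg h)
    simp only [bdry_singleton] at hab
    have h1 : bdry G {g a} ⊆ {s(g a, g b)} := by
      rw [bdry_singleton]
      have := SimpleGraph.incidenceSet_inter_incidenceSet_subset G hne'
      rwa [← hab, Set.inter_self] at this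
    have h2 := Set.ncard_le_ncard h1
    rw [hdeg, Set.ncard_singleton] at h2
    omega
  · intro X
    constructor
    · intro hX
      refine key X hX.1 ?_
      have := hX.2 _ (hcut (Classical.arbitrary U))
      rwa [hdeg] at this
    · rintro ⟨u, rfl⟩
      refine ⟨hcut u, fun Y hY => ?_⟩
      rw [hdeg]
      by_contra hlt
      push Not at hlt
      obtain ⟨w, hw⟩ := key Y hY hlt.le
      rw [← hw, hdeg] at hlt
      exact lt_irrefl _ hlt
  · intro a b hab
    have hne' : g a ≠ g b := fun h => hab (hg h)
    simp only [bdry_singleton, SimpleGraph.comap_adj]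
    constructor
    · intro hadj
      exact ⟨s(g a, g b), ⟨hadj, by simp⟩, ⟨hadj, by simp⟩⟩
    · rintro ⟨e, h1, h2⟩
      exact SimpleGraph.adj_of_mem_incidenceSet G hne' h1 h2

open Fin.NatCast in
lemma rot {m : ℕ} (S : Set (Fin (m + 4))) (h1 : S.Nonempty) (h2 : Sᶜ.Nonempty) :
    ∃ i, i ∈ S ∧ i + 1 ∉ S := by
  by_contra hcon
  push Not at hcon
  obtain ⟨a, ha⟩ := h1
  obtain ⟨b, hb⟩ := h2
  have hall : ∀ n : ℕ, a + (n : Fin (m + 4)) ∈ S := by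
    intro n
    induction n with
    | zero => simpa using ha
    | succ n ih =>
      have := hcon _ ih
      rwa [add_assoc, ← Nat.cast_succ] at this
  apply hb
  have := hall (b - a).val
  rwa [Fin.cast_val_eq_self, add_sub_cancel] at this

lemma one_add_one_ne {m : ℕ} : (1 + 1 : Fin (m + 4)) ≠ 0 := by
  intro h
  have := congrArg Fin.val h
  simp [Fin.val_add] at this
  rw [Nat.mod_eq_of_lt (by omega)] at this
  omega

lemma cyc_adj {m : ℕ} (i : Fin (m + 4)) : (SimpleGraph.cycleGraph (m + 4)).Adj i (i + 1) := by
  rw [SimpleGraph.cycleGraph_adj]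
  right
  simp

lemma cyc_adj_iff {m : ℕ} (i j : Fin (m + 4)) :
    (SimpleGraph.cycleGraph (m + 4)).Adj i j ↔ j = i + 1 ∨ i = j + 1 := by
  rw [SimpleGraph.cycleGraph_adj, sub_eq_iff_eq_add', sub_eq_iff_eq_add']
  tauto

/-- The edges of the cycle. -/
def cyE {m : ℕ} (i : Fin (m + 4)) : Sym2 (Fin (m + 4)) := s(i, i + 1)

lemma cyE_inj {m : ℕ} : Function.Injective (cyE (m := m)) := by
  intro i j h
  rw [cyE, cyE, Sym2.eq_iff] at h
  rcases h with h | ⟨h1, h2⟩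
  · exact h.1
  · exfalso
    rw [h1, add_assoc] at h2
    exact one_add_one_ne (left_eq_add.1 h2.symm)

lemma cyE_surj {m : ℕ} (e : Sym2 (Fin (m + 4))) (he : e ∈ (SimpleGraph.cycleGraph (m + 4)).edgeSet) :
    ∃ i, cyE i = e := by
  induction e with | _ a b =>
  rw [SimpleGraph.mem_edgeSet, cyc_adj_iff] at he
  rcases he with rfl | rfl
  · exact ⟨a, rfl⟩
  · exact ⟨b, Sym2.eq_swap⟩

lemma two_bdry {m : ℕ} (S : Set (Fin (m + 4))) (h1 : S.Nonempty) (h2 : Sᶜ.Nonempty) :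
    ∃ i j, i ≠ j ∧ ((i ∈ S ∧ i + 1 ∉ S)) ∧ ((j ∉ S ∧ j + 1 ∈ S)) := by
  obtain ⟨i, hi, hi'⟩ := rot S h1 h2
  obtain ⟨j, hj, hj'⟩ := rot Sᶜ h2 (by simpa using h1)
  refine ⟨i, j, ?_, ⟨hi, hi'⟩, ⟨hj, by simpa using hj'⟩⟩
  rintro rfl
  exact hj hi

lemma cyc_cut_two {m : ℕ} (X : Set (Sym2 (Fin (m + 4))))
    (hX : IsEdgeCut (SimpleGraph.cycleGraph (m + 4)) X) : 2 ≤ X.ncard := by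
  obtain ⟨S, h1, h2, h3⟩ := edgeCut_exists _ X hX
  obtain ⟨i, j, hij, hi, hj⟩ := two_bdry S h1 h2
  rw [← Set.ncard_pair (cyE_inj.ne hij)]
  apply Set.ncard_le_ncard _ (Set.toFinite _)
  rintro e (rfl | rfl)
  · exact h3 ((mem_bdry _ _ _ _).2 ⟨cyc_adj i, Or.inl hi⟩)
  · exact h3 ((mem_bdry _ _ _ _).2 ⟨cyc_adj j, Or.inr hj.symm⟩)

lemma val_succ_cases {m : ℕ} (x : Fin (m + 4)) :
    ((x + 1).val = x.val + 1 ∧ x.val < m + 3) ∨ ((x + 1).val = 0 ∧ x.val = m + 3) := by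
  rcases eq_or_lt_of_le (Fin.le_last x) with h | h
  · right
    subst h
    simp
  · left
    exact ⟨Fin.val_add_one_of_lt h, h⟩

lemma cyc_pair_cut {m : ℕ} (i j : Fin (m + 4)) (hij : i < j) :
    IsEdgeCut (SimpleGraph.cycleGraph (m + 4)) {cyE i, cyE j} := by
  have : bdry (SimpleGraph.cycleGraph (m + 4)) {x | i < x ∧ x ≤ j} = {cyE i, cyE j} := by
    ext e
    constructor
    · intro he
      have he' : e ∈ (SimpleGraph.cycleGraph (m + 4)).edgeSet := by
        obtain ⟨u, v, _, _, h, rfl⟩ := he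
        exact h
      obtain ⟨x, rfl⟩ := cyE_surj e he'
      rw [cyE, mem_bdry] at he
      simp only [Set.mem_ofPred_eq, Fin.lt_def, Fin.le_def] at he
      have hj := j.isLt
      rw [Fin.lt_def] at hij
      have : x = i ∨ x = j := by
        rw [Fin.ext_iff, Fin.ext_iff]
        rcases val_succ_cases x with h | h <;> omega
      rcases this with rfl | rfl <;> simp
    · rw [Fin.lt_def] at hij
      have hj := j.isLt
      rintro (rfl | rfl)
      · rw [cyE, mem_bdry]
        refine ⟨cyc_adj _, ?_⟩
        simp only [Set.mem_ofPred_eq, Fin.lt_def, Fin.le_def]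
        rcases val_succ_cases i with h | h <;> omega
      · rw [cyE, mem_bdry]
        refine ⟨cyc_adj _, ?_⟩
        simp only [Set.mem_ofPred_eq, Fin.lt_def, Fin.le_def]
        rcases val_succ_cases j with h | h <;> omega
  rw [← this]
  exact bdry_isEdgeCut _ _ ⟨j, hij, le_refl _⟩ ⟨i, fun h => lt_irrefl _ h.1⟩

lemma cyc_pair_cut' {m : ℕ} (i j : Fin (m + 4)) (hij : i ≠ j) :
    IsEdgeCut (SimpleGraph.cycleGraph (m + 4)) {cyE i, cyE j} := by
  rcases lt_or_gt_of_ne hij with h | h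
  · exact cyc_pair_cut i j h
  · rw [Set.pair_comm]
    exact cyc_pair_cut j i h

lemma cyc_iso (m : ℕ) : Nonempty (mincutGraph (SimpleGraph.cycleGraph (m + 4)) ≃g
    (⊤ : SimpleGraph (Fin (m + 4))).lineGraph) := by
  have hpair : ∀ a b : Fin (m + 4), cyE '' (s(a, b) : Set (Fin (m + 4))) = {cyE a, cyE b} := by
    intro a b
    rw [Sym2.coe_mk, Set.image_pair]
  have hmin : ∀ a b : Fin (m + 4), a ≠ b →
      IsMinCut (SimpleGraph.cycleGraph (m + 4)) {cyE a, cyE b} := by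
    intro a b hab
    refine ⟨cyc_pair_cut' a b hab, fun Y hY => ?_⟩
    rw [Set.ncard_pair (cyE_inj.ne hab)]
    exact cyc_cut_two Y hY
  refine iso_of_cuts _ _ (fun e => cyE '' (e.1 : Set (Fin (m + 4)))) ?_ ?_ ?_
  · intro e f h
    exact Subtype.ext (SetLike.coe_injective (cyE_inj.image_injective h))
  · intro X
    constructor
    · intro hX
      have h2 : X.ncard = 2 := by
        apply le_antisymm _ (cyc_cut_two X hX.1)
        have := hX.2 _ (cyc_pair_cut' 0 1 (by simp))
        rwa [Set.ncard_pair (cyE_inj.ne (by simp))] at this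
      obtain ⟨x, y, hxy, rfl⟩ := Set.ncard_eq_two.1 h2
      obtain ⟨a, rfl⟩ := cyE_surj x (hX.1.1 (by simp))
      obtain ⟨b, rfl⟩ := cyE_surj y (hX.1.1 (by simp))
      refine ⟨⟨s(a, b), ?_⟩, hpair a b⟩
      simp only [SimpleGraph.mem_edgeSet, SimpleGraph.top_adj]
      exact fun h => hxy (by rw [h])
    · rintro ⟨⟨e, he⟩, rfl⟩
      induction e with | _ a b =>
      simp only [SimpleGraph.mem_edgeSet, SimpleGraph.top_adj] at he
      simp only [hpair]
      exact hmin a b he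
  · intro e f hef
    rw [← Set.image_inter cyE_inj, Set.image_nonempty, SimpleGraph.lineGraph_adj_iff_exists]
    exact ⟨fun h => h.2, fun h => ⟨hef, h⟩⟩

lemma wheel_none {k : ℕ} (i : Fin k) : (wheelGraph k).Adj (some i) none := by
  simp [wheelGraph]

lemma wheel_some {k : ℕ} (i j : Fin k) :
    (wheelGraph k).Adj (some i) (some j) ↔ (SimpleGraph.cycleGraph k).Adj i j := by
  simp only [wheelGraph, SimpleGraph.fromRel_adj]
  constructor
  · rintro ⟨h, (⟨h1, _⟩ | ⟨a, b, ha, hb, h2⟩) | (⟨h1, _⟩ | ⟨a, b, ha, hb, h2⟩)⟩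
    · simp at h1
    · cases ha; cases hb; exact h2
    · simp at h1
    · cases ha; cases hb; exact h2.symm
  · intro h
    refine ⟨fun h' => h.ne (Option.some_injective _ h'), Or.inl (Or.inr ⟨i, j, rfl, rfl, h⟩)⟩

lemma wheel_deg {m : ℕ} (i : Fin (m + 4)) :
    (bdry (wheelGraph (m + 4)) {some i}).ncard = 3 := by
  have : bdry (wheelGraph (m + 4)) {some i} =
      {s(some i, none), s(some i, some (i + 1)), s(some i, some (i - 1))} := by
    ext e
    constructor
    · rintro ⟨u, v, rfl, hv, hadj, rfl⟩
      rcases v with _ | j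
      · simp
      · rw [wheel_some, cyc_adj_iff] at hadj
        rcases hadj with rfl | h
        · simp
        · have : j = i - 1 := by rw [h]; simp
          subst this
          simp
    · rintro (rfl | rfl | rfl)
      · exact ⟨_, _, rfl, by simp, wheel_none i, rfl⟩
      · have := cyc_adj i
        exact ⟨_, _, rfl, fun h => this.ne (Option.some_injective _ h).symm,
          (wheel_some _ _).2 this, rfl⟩
      · have : (SimpleGraph.cycleGraph (m + 4)).Adj i (i - 1) := by
          rw [cyc_adj_iff]; right; simp
        exact ⟨_, _, rfl, fun h => this.ne (Option.some_injective _ h).symm,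
          (wheel_some _ _).2 this, rfl⟩
  rw [this, Set.ncard_eq_three]
  refine ⟨_, _, _, ?_, ?_, ?_, rfl⟩
  · simp
  · simp
  · intro h
    have h1 := Option.some_injective _ (Sym2.congr_right.1 h)
    rw [eq_sub_iff_add_eq, add_assoc] at h1
    exact one_add_one_ne (add_eq_left.1 h1)

lemma wheel_cut {m : ℕ} (S : Set (Option (Fin (m + 4)))) (h1 : S.Nonempty) (h0 : none ∉ S)
    (h : (bdry (wheelGraph (m + 4)) S).ncard ≤ 3) : ∃ u, S = {some u} := by
  have hspoke : ∀ a, some a ∈ S → s(some a, none) ∈ bdry (wheelGraph (m + 4)) S :=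
    fun a ha => ⟨_, _, ha, h0, wheel_none a, rfl⟩
  have hsinj : Function.Injective
      (fun a : Fin (m + 4) => (s(some a, none) : Sym2 (Option (Fin (m + 4))))) := by
    intro a b hab
    simpa using hab
  obtain ⟨a, ha⟩ : ∃ a, some a ∈ S := by
    obtain ⟨x, hx⟩ := h1
    rcases x with _ | a
    · exact absurd hx h0
    · exact ⟨a, hx⟩
  by_cases hall : ∀ b, some b ∈ S
  · exfalso
    have hsub : (fun a : Fin (m + 4) => (s(some a, none) : Sym2 (Option (Fin (m + 4))))) ''
        Set.univ ⊆ bdry (wheelGraph (m + 4)) S := by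
      rintro _ ⟨b, _, rfl⟩
      exact hspoke b (hall b)
    have := Set.ncard_le_ncard hsub
    rw [Set.ncard_image_of_injective _ hsinj, Set.ncard_univ, Nat.card_fin] at this
    omega
  · push Not at hall
    refine ⟨a, ?_⟩
    by_contra hne
    obtain ⟨b, hb, hab⟩ : ∃ b, some b ∈ S ∧ a ≠ b := by
      by_contra hcon
      push Not at hcon
      apply hne
      ext x
      constructor
      · intro hx
        rcases x with _ | b
        · exact absurd hx h0
        · rw [hcon b hx]; rfl
      · rintro rfl
        exact ha
    obtain ⟨i, j, hij, hi, hj⟩ := two_bdry {x | some x ∈ S} ⟨a, ha⟩ hall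
    have hsub : ({s(some a, none), s(some b, none), s(some i, some (i + 1)),
        s(some j, some (j + 1))} : Set (Sym2 (Option (Fin (m + 4))))) ⊆
          bdry (wheelGraph (m + 4)) S := by
      rintro e (rfl | rfl | rfl | rfl)
      · exact hspoke _ ha
      · exact hspoke _ hb
      · exact (mem_bdry _ _ _ _).2 ⟨(wheel_some _ _).2 (cyc_adj i), Or.inl hi⟩
      · exact (mem_bdry _ _ _ _).2 ⟨(wheel_some _ _).2 (cyc_adj j), Or.inr hj.symm⟩
    have hle := Set.ncard_le_ncard hsub
    have hne2 : (s(some i, some (i + 1)) : Sym2 (Option (Fin (m + 4)))) ≠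
        s(some j, some (j + 1)) := by
      intro h
      have h' : Sym2.map some (cyE i) = Sym2.map some (cyE j) := h
      exact hij (cyE_inj (Sym2.map.injective (Option.some_injective _) h'))
    rw [Set.ncard_insert_of_notMem, Set.ncard_insert_of_notMem, Set.ncard_pair hne2] at hle
    · omega
    · simp
    · simp [hab]

lemma wheel_iso (m : ℕ) : Nonempty (mincutGraph (wheelGraph (m + 4)) ≃g
    SimpleGraph.cycleGraph (m + 4)) := by
  have hc : (wheelGraph (m + 4)).comap some = SimpleGraph.cycleGraph (m + 4) := by
    ext i j
    exact wheel_some i j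
  rw [← hc]
  refine iso_of_super _ some (Option.some_injective _) 3 (by norm_num) wheel_deg ?_
  intro S h1 h2 h
  by_cases h0 : none ∈ S
  · obtain ⟨u, hu⟩ := wheel_cut Sᶜ h2 (by simpa using h0) (by rwa [bdry_compl])
    exact ⟨u, Or.inr hu⟩
  · obtain ⟨u, hu⟩ := wheel_cut S h1 h0 h
    exact ⟨u, Or.inl hu⟩

section LineK
open Classical

/-- neighbours of `v` along edges in `S`. -/
noncomputable def nbS {k : ℕ} (S : Set (⊤ : SimpleGraph (Fin k)).edgeSet) (v : Fin k) :
    Finset (Fin k) :=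
  Finset.univ.filter (fun a => s(v, a) ∈ Subtype.val '' S)

lemma mem_nbS {k : ℕ} (S : Set (⊤ : SimpleGraph (Fin k)).edgeSet) (v a : Fin k) :
    a ∈ nbS S v ↔ s(v, a) ∈ Subtype.val '' S := by
  simp only [nbS, Finset.mem_filter, Finset.mem_univ, true_and]

lemma mem_nbS_comm {k : ℕ} (S : Set (⊤ : SimpleGraph (Fin k)).edgeSet) (v a : Fin k) :
    a ∈ nbS S v ↔ v ∈ nbS S a := by
  rw [mem_nbS, mem_nbS, Sym2.eq_swap]

lemma nbS_ne {k : ℕ} (S : Set (⊤ : SimpleGraph (Fin k)).edgeSet) (v a : Fin k)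
    (h : a ∈ nbS S v) : v ≠ a := by
  rw [mem_nbS] at h
  obtain ⟨⟨x, hx⟩, _, h2⟩ := h
  simp only at h2
  subst h2
  simpa using hx

lemma mem_nbS_compl {k : ℕ} (S : Set (⊤ : SimpleGraph (Fin k)).edgeSet) (v a : Fin k)
    (h : v ≠ a) : a ∈ nbS Sᶜ v ↔ a ∉ nbS S v := by
  rw [mem_nbS, mem_nbS]
  constructor
  · rintro ⟨x, hx, h1⟩ ⟨y, hy, h2⟩
    exact hx (Subtype.ext (h1.trans h2.symm) ▸ hy)
  · intro h2
    exact ⟨⟨s(v, a), by simpa using h⟩, fun h3 => h2 ⟨_, h3, rfl⟩, rfl⟩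

lemma nbS_card {k : ℕ} (S : Set (⊤ : SimpleGraph (Fin k)).edgeSet) (v : Fin k) :
    (nbS S v).card + (nbS Sᶜ v).card = k - 1 := by
  rw [← Finset.card_union_of_disjoint]
  · have : nbS S v ∪ nbS Sᶜ v = Finset.univ.erase v := by
      ext a
      simp only [Finset.mem_union, Finset.mem_erase, Finset.mem_univ, and_true]
      constructor
      · rintro (h | h)
        · exact (nbS_ne _ _ _ h).symm
        · exact (nbS_ne _ _ _ h).symm
      · intro h
        rw [mem_nbS_compl _ _ _ h.symm]
        tauto
    rw [this, Finset.card_erase_of_mem (Finset.mem_univ _), Finset.card_univ, Fintype.card_fin]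
  · rw [Finset.disjoint_left]
    intro a h1 h2
    exact (mem_nbS_compl _ _ _ (nbS_ne _ _ _ h1)).1 h2 h1

lemma bdry_line_card {k : ℕ} (S : Set (⊤ : SimpleGraph (Fin k)).edgeSet) :
    (bdry (⊤ : SimpleGraph (Fin k)).lineGraph S).ncard =
      ∑ v, (nbS S v).card * (nbS Sᶜ v).card := by
  have h1 : ∑ v, (nbS S v).card * (nbS Sᶜ v).card =
      (Finset.univ.sigma (fun v => nbS S v ×ˢ nbS Sᶜ v)).card := by
    rw [Finset.card_sigma]
    simp only [Finset.card_product]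
  rw [h1, ← Set.ncard_coe_finset]
  symm
  have hval : Function.Injective
      (Sym2.map (Subtype.val : (⊤ : SimpleGraph (Fin k)).edgeSet → Sym2 (Fin k))) :=
    Sym2.map.injective Subtype.val_injective
  rw [← Set.ncard_image_of_injective _ hval]
  refine Set.ncard_congr (fun t _ => s(s(t.1, t.2.1), s(t.1, t.2.2))) ?_ ?_ ?_
  · rintro ⟨v, a, b⟩ ht
    simp only [Finset.coe_sigma, Set.mem_sigma_iff, Finset.mem_coe, Finset.mem_product] at ht
    obtain ⟨_, ha, hb⟩ := ht
    rw [mem_nbS] at ha hb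
    obtain ⟨x, hx, hx'⟩ := ha
    obtain ⟨y, hy, hy'⟩ := hb
    refine ⟨s(x, y), ⟨x, y, hx, hy, ?_, rfl⟩, ?_⟩
    · rw [SimpleGraph.lineGraph_adj_iff_exists]
      refine ⟨fun h => hy (h ▸ hx), v, ?_, ?_⟩
      · rw [hx']; simp
      · rw [hy']; simp
    · simp only [Sym2.map_mk, hx', hy']
  · rintro ⟨v, a, b⟩ ⟨v', a', b'⟩ ht ht' h
    simp only [Finset.coe_sigma, Set.mem_sigma_iff, Finset.mem_coe, Finset.mem_product] at ht ht'
    obtain ⟨_, ha, hb⟩ := ht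
    obtain ⟨_, ha', hb'⟩ := ht'
    have hva := nbS_ne _ _ _ ha
    have hvb := nbS_ne _ _ _ hb
    have hva' := nbS_ne _ _ _ ha'
    have hvb' := nbS_ne _ _ _ hb'
    have hb1 := (mem_nbS_compl _ _ _ hvb).1 hb
    have hb1' := (mem_nbS_compl _ _ _ hvb').1 hb'
    have hab : a ≠ b := fun h => hb1 (h ▸ ha)
    have hab' : a' ≠ b' := fun h => hb1' (h ▸ ha')
    rw [mem_nbS] at ha ha' hb1 hb1'
    simp only at h
    rw [Sym2.eq_iff] at h
    rcases h with ⟨h2, h3⟩ | ⟨h2, h3⟩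
    · rw [Sym2.eq_iff] at h2 h3
      have : v = v' ∧ a = a' ∧ b = b' := by
        clear ha ha' hb hb' hb1 hb1' h1 hval
        rcases h2 with ⟨rfl, rfl⟩ | ⟨rfl, rfl⟩
        · rcases h3 with ⟨_, rfl⟩ | ⟨rfl, rfl⟩
          · exact ⟨rfl, rfl, rfl⟩
          · exact absurd rfl hvb
        · rcases h3 with ⟨rfl, _⟩ | ⟨rfl, rfl⟩
          · exact absurd rfl hva
          · exact absurd rfl hab
      obtain ⟨rfl, rfl, rfl⟩ := this
      rfl
    · rw [h2] at ha
      exact absurd ha hb1'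
  · rintro _ ⟨e, ⟨x, y, hx, hy, hadj, rfl⟩, rfl⟩
    rw [SimpleGraph.lineGraph_adj_iff_exists] at hadj
    obtain ⟨hne, v, hv1, hv2⟩ := hadj
    obtain ⟨a, ha⟩ := hv1
    obtain ⟨b, hb⟩ := hv2
    refine ⟨⟨v, a, b⟩, ?_, ?_⟩
    · simp only [Finset.coe_sigma, Set.mem_sigma_iff, Finset.mem_coe, Finset.mem_product,
        Finset.mem_univ, true_and, mem_nbS]
      exact ⟨⟨x, hx, ha⟩, ⟨y, hy, hb⟩⟩
    · simp only [Sym2.map_mk, ha, hb]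

lemma line_deg {k : ℕ} (e : (⊤ : SimpleGraph (Fin k)).edgeSet) :
    (bdry (⊤ : SimpleGraph (Fin k)).lineGraph {e}).ncard = 2 * (k - 2) := by
  rw [bdry_line_card]
  obtain ⟨e, he⟩ := e
  induction e with | _ p q =>
  have hpq : p ≠ q := by simpa using he
  have hmem : ∀ v a, a ∈ nbS {(⟨s(p, q), he⟩ : (⊤ : SimpleGraph (Fin k)).edgeSet)} v ↔
      (v = p ∧ a = q) ∨ (v = q ∧ a = p) := by
    intro v a
    rw [mem_nbS, Set.image_singleton, Set.mem_singleton_iff, Sym2.eq_iff]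
  have hp : nbS {(⟨s(p, q), he⟩ : (⊤ : SimpleGraph (Fin k)).edgeSet)} p = {q} := by
    ext a
    rw [hmem, Finset.mem_singleton]
    simp [hpq]
  have hq : nbS {(⟨s(p, q), he⟩ : (⊤ : SimpleGraph (Fin k)).edgeSet)} q = {p} := by
    ext a
    rw [hmem, Finset.mem_singleton]
    simp [hpq.symm]
  have hcp := nbS_card {(⟨s(p, q), he⟩ : (⊤ : SimpleGraph (Fin k)).edgeSet)} p
  have hcq := nbS_card {(⟨s(p, q), he⟩ : (⊤ : SimpleGraph (Fin k)).edgeSet)} q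
  rw [hp, Finset.card_singleton] at hcp
  rw [hq, Finset.card_singleton] at hcq
  rw [← Finset.sum_subset (Finset.subset_univ {p, q}), Finset.sum_pair hpq, hp, hq,
    Finset.card_singleton, Finset.card_singleton]
  · omega
  · intro x _ hx
    simp only [Finset.mem_insert, Finset.mem_singleton, not_or] at hx
    have : nbS {(⟨s(p, q), he⟩ : (⊤ : SimpleGraph (Fin k)).edgeSet)} x = ∅ := by
      ext a
      rw [hmem]
      simp [hx.1, hx.2]
    rw [this]
    simp

lemma line_single {k : ℕ} (S : Set (⊤ : SimpleGraph (Fin k)).edgeSet) (hS : S.Nonempty)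
    (M : Finset (Fin k)) (hM : M.card ≤ 2) (h : ∀ v, v ∉ M → nbS S v = ∅) :
    ∃ e, S = {e} := by
  have hmem : ∀ a b (hab : s(a, b) ∈ (⊤ : SimpleGraph (Fin k)).edgeSet), ⟨s(a, b), hab⟩ ∈ S →
      a ∈ M ∧ b ∈ M := by
    intro a b hab hin
    have h1 : b ∈ nbS S a := (mem_nbS _ _ _).2 ⟨_, hin, rfl⟩
    have h2 : a ∈ nbS S b := (mem_nbS_comm _ _ _).1 h1
    constructor
    · by_contra hn
      rw [h a hn] at h1
      simp at h1
    · by_contra hn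
      rw [h b hn] at h2
      simp at h2
  obtain ⟨⟨e, he⟩, heS⟩ := hS
  refine ⟨⟨e, he⟩, ?_⟩
  induction e with | _ a b =>
  have hab : a ≠ b := by simpa using he
  have habM := hmem a b he heS
  have hMeq : {a, b} = M := by
    apply Finset.eq_of_subset_of_card_le
    · intro x hx
      simp only [Finset.mem_insert, Finset.mem_singleton] at hx
      rcases hx with rfl | rfl
      · exact habM.1
      · exact habM.2
    · rw [Finset.card_pair hab]; exact hM
  ext ⟨f, hf⟩
  constructor
  · intro hfS
    induction f with | _ c d =>
    have hcd : c ≠ d := by simpa using hf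
    have hcdM := hmem c d hf hfS
    rw [← hMeq] at hcdM
    simp only [Finset.mem_insert, Finset.mem_singleton] at hcdM
    apply Subtype.ext
    simp only
    rw [Sym2.eq_iff]
    obtain ⟨rfl | rfl, rfl | rfl⟩ := hcdM
    · exact absurd rfl hcd
    · exact Or.inl ⟨rfl, rfl⟩
    · exact Or.inr ⟨rfl, rfl⟩
    · exact absurd rfl hcd
  · intro hfe
    rw [Set.mem_singleton_iff] at hfe
    rw [hfe]
    exact heS

lemma line_cut {k : ℕ} (hk : 4 ≤ k) (S : Set (⊤ : SimpleGraph (Fin k)).edgeSet)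
    (hS : S.Nonempty) (hS' : Sᶜ.Nonempty)
    (h : (bdry (⊤ : SimpleGraph (Fin k)).lineGraph S).ncard ≤ 2 * (k - 2)) :
    ∃ e, S = {e} ∨ Sᶜ = {e} := by
  rw [bdry_line_card] at h
  let M : Finset (Fin k) := Finset.univ.filter (fun v => nbS S v ≠ ∅ ∧ nbS Sᶜ v ≠ ∅)
  have hMmem : ∀ v, v ∉ M → nbS S v = ∅ ∨ nbS Sᶜ v = ∅ := by
    intro v hv
    simp only [M, Finset.mem_filter, Finset.mem_univ, true_and] at hv
    tauto
  have hM : M.card ≤ 2 := by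
    by_contra hcon
    push Not at hcon
    have h1 : M.card * (k - 2) ≤ ∑ v ∈ M, (nbS S v).card * (nbS Sᶜ v).card := by
      rw [← smul_eq_mul]
      apply Finset.card_nsmul_le_sum
      intro v hv
      simp only [M, Finset.mem_filter, Finset.mem_univ, true_and] at hv
      have ha := Finset.card_pos.2 (Finset.nonempty_iff_ne_empty.2 hv.1)
      have hb := Finset.card_pos.2 (Finset.nonempty_iff_ne_empty.2 hv.2)
      have hc := nbS_card S v
      obtain ⟨x, hx⟩ := Nat.exists_eq_add_of_le' ha
      obtain ⟨y, hy⟩ := Nat.exists_eq_add_of_le' hb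
      rw [hx, hy] at hc ⊢
      have : k - 2 = x + y + 1 := by omega
      rw [this]
      nlinarith [Nat.zero_le (x * y)]
    have h2 : ∑ v ∈ M, (nbS S v).card * (nbS Sᶜ v).card ≤
        ∑ v, (nbS S v).card * (nbS Sᶜ v).card :=
      Finset.sum_le_sum_of_subset (Finset.subset_univ M)
    have h3 : 3 * (k - 2) ≤ M.card * (k - 2) := Nat.mul_le_mul_right _ hcon
    omega
  by_cases hcase : ∀ v, v ∉ M → nbS S v = ∅
  · obtain ⟨e, he⟩ := line_single S hS M hM hcase
    exact ⟨e, Or.inl he⟩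
  · push Not at hcase
    obtain ⟨u, huM, hu⟩ := hcase
    have hu' : nbS Sᶜ u = ∅ := by
      rcases hMmem u huM with h | h
      · rw [h] at hu
        simp at hu
      · exact h
    have hall : ∀ v, v ∉ M → nbS Sᶜ v = ∅ := by
      intro w hw
      rcases hMmem w hw with h | h
      · by_cases huw : w = u
        · rw [huw]; exact hu'
        · exfalso
          have h1 : u ∉ nbS S w := by rw [h]; simp
          have h2 := (mem_nbS_compl S w u huw).2 h1
          rw [mem_nbS_comm, hu'] at h2
          simp at h2
      · exact h
    obtain ⟨e, he⟩ := line_single Sᶜ hS' M hM hall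
    exact ⟨e, Or.inr he⟩

lemma line_iso (k : ℕ) (hk : 4 ≤ k) : Nonempty (mincutGraph (⊤ : SimpleGraph (Fin k)).lineGraph ≃g
    (⊤ : SimpleGraph (Fin k)).lineGraph) := by
  have : Nonempty (⊤ : SimpleGraph (Fin k)).edgeSet :=
    ⟨⟨s(⟨0, by omega⟩, ⟨1, by omega⟩), by simp⟩⟩
  exact iso_of_super (⊤ : SimpleGraph (Fin k)).lineGraph id Function.injective_id (2 * (k - 2))
    (by omega) line_deg (line_cut hk)

end LineK

theorem mincut_operator_wheel (n : ℕ) (hn : 4 < n) :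
    Nonempty (mincutGraph (mincutGraph (wheelGraph (n - 1)))
        ≃g (⊤ : SimpleGraph (Fin (n - 1))).lineGraph) ∧
      Nonempty (mincutGraph ((⊤ : SimpleGraph (Fin (n - 1))).lineGraph)
        ≃g (⊤ : SimpleGraph (Fin (n - 1))).lineGraph) := by
  obtain ⟨m, rfl⟩ : ∃ m, n = m + 5 := ⟨n - 5, by omega⟩
  have hm : m + 5 - 1 = m + 4 := rfl
  rw [hm]
  refine ⟨?_, line_iso (m + 4) (by omega)⟩
  obtain ⟨e1⟩ := wheel_iso m
  obtain ⟨e2⟩ := mincutGraph_congr e1.symm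
  obtain ⟨e3⟩ := cyc_iso m
  exact ⟨e2.trans e3⟩
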